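/- arXiv:2512.02855 — 4 statements merged into one kernel-verified Lean document; each statement's English description precedes it below -/
import Mathlib

section
/- Invariance of the invariant entropy under time reparametrization (Corollary 2.3): Let ρ be as in the context, let t : ℝ → ℝ be an increasing C¹ diffeomorphism, and set ρ̃_s(θ) = t'(s)·ρ_{t(s)}(θ) and m̃_s = t'(s)·m_{t(s)}. Assume ∬_{S¹×ℝ} |ρ_t(θ) log(2π ρ_t(θ))| dθ dt < ∞, ∫_ℝ |m_t log m_t| dt < ∞ and ∫_ℝ |m̃_s log m̃_s| ds < ∞. Then 𝓗_inv(ρ̃) = 𝓗_inv(ρ), where 𝓗_inv(σ) = ∬_{S¹×ℝ} σ_t(θ) log(2π σ_t(θ)) dθ dt − ∫_ℝ |σ_t| log|σ_t| dt and |σ_t| = ∫₀^{2π} σ_t(θ) dθ. -/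
open MeasureTheory Filter Real Set
open scoped ENNReal

noncomputable section

/-- The marginal mass `m_t = ∫₀^{2π} ρ_t(θ) dθ` of a measurable family of densities on the
circle, identified with `[0,2π)`. -/
def marginalMass (ρ : ℝ → ℝ → ℝ) (t : ℝ) : ℝ := ∫ θ in Set.Ioc 0 (2 * π), ρ t θ

/-- The measure `dt ⊗ dθ` on `ℝ × S¹`, with the circle identified with `(0,2π]`
(first coordinate is time `t`, second is the angle `θ`). -/
def timeTheta : Measure (ℝ × ℝ) :=
  (volume : Measure ℝ).prod ((volume : Measure ℝ).restrict (Set.Ioc 0 (2 * π)))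

lemma aux_mp (τ τ' : ℝ → ℝ) (hτ : ∀ s, HasDerivAt τ (τ' s) s)
    (hτpos : ∀ s, 0 < τ' s) (hτsurj : Function.Surjective τ) :
    MeasurePreserving τ ((volume : Measure ℝ).withDensity (fun s => ENNReal.ofReal (τ' s)))
      volume := by
  have hmono : StrictMono τ := strictMono_of_hasDerivAt_pos hτ hτpos
  have hm : Measurable τ := hmono.monotone.measurable
  refine ⟨hm, ?_⟩
  ext s hs
  rw [Measure.map_apply hm hs, withDensity_apply _ (hm hs),
    lintegral_deriv_eq_volume_image_of_monotoneOn (hm hs)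
      (fun x _ => (hτ x).hasDerivWithinAt) (hmono.monotone.monotoneOn _),
    image_preimage_eq _ hτsurj]

lemma aux_cov {α : Type*} [MeasurableSpace α] (μ : Measure α) (d : α → ℝ) (hd : Measurable d)
    (hd0 : ∀ a, 0 ≤ d a) (T : α → α)
    (hT : MeasurePreserving T (μ.withDensity (fun a => ENNReal.ofReal (d a))) μ)
    (g : α → ℝ) (hg : Integrable g μ) :
    Integrable (fun a => d a * g (T a)) μ ∧ ∫ a, d a * g (T a) ∂μ = ∫ a, g a ∂μ := by
  have hE : Measurable (fun a => ENNReal.ofReal (d a)) := hd.ennreal_ofReal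
  have hlt : ∀ᵐ a ∂μ, ENNReal.ofReal (d a) < ∞ := ae_of_all _ fun a => ENNReal.ofReal_lt_top
  constructor
  · have h := (hT.integrable_comp hg.aestronglyMeasurable).2 hg
    rw [integrable_withDensity_iff_integrable_smul' hE hlt] at h
    simpa [ENNReal.toReal_ofReal (hd0 _)] using h
  · have h : ∫ a, g a ∂μ = ∫ a, g (T a) ∂(μ.withDensity (fun a => ENNReal.ofReal (d a))) := by
      conv_lhs => rw [← hT.map_eq]
      rw [integral_map hT.measurable.aemeasurable]
      rw [hT.map_eq]; exact hg.aestronglyMeasurable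
    rw [h, integral_withDensity_eq_integral_toReal_smul hE hlt]
    simp [ENNReal.toReal_ofReal (hd0 _)]

lemma aux_log (a x : ℝ) (ha : 0 < a) (c : ℝ) (hc : 0 < c) :
    (a * x) * Real.log (c * (a * x)) = a * (x * Real.log (c * x)) + a * x * Real.log a := by
  by_cases hx : x = 0
  · simp [hx]
  · have : c * (a * x) = a * (c * x) := by ring
    rw [this, Real.log_mul ha.ne' (mul_ne_zero hc.ne' hx)]
    ring

lemma aux_bound (x : ℝ) (hx : 0 ≤ x) : x ≤ Real.exp 1 + |x * Real.log (2 * π * x)| := by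
  by_cases h : x ≤ Real.exp 1
  · have := abs_nonneg (x * Real.log (2 * π * x))
    linarith
  · push Not at h
    have hx0 : 0 < x := lt_trans (Real.exp_pos 1) h
    have h1 : 1 ≤ Real.log (2 * π * x) := by
      rw [Real.le_log_iff_exp_le (by positivity)]
      nlinarith [Real.pi_gt_three]
    have h2 := le_abs_self (x * Real.log (2 * π * x))
    have := Real.exp_pos 1
    nlinarith

/-- **Invariance of the invariant entropy under time reparametrization** (Corollary 2.3):
if `t : ℝ → ℝ` (here `τ`) is an increasing C¹ diffeomorphism and
`ρ̃_s(θ) = τ'(s)·ρ_{τ(s)}(θ)`, `m̃_s = τ'(s)·m_{τ(s)}`, then, under the stated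
integrability assumptions, `𝓗_inv(ρ̃) = 𝓗_inv(ρ)` where
`𝓗_inv(σ) = ∬ σ log(2π σ) dθ dt − ∫ |σ_t| log |σ_t| dt`. -/
theorem invariant_entropy_time_reparam
    (ρ : ℝ → ℝ → ℝ)
    (hmeas : Measurable (Function.uncurry ρ))
    (hnonneg : ∀ t θ, 0 ≤ ρ t θ)
    (hloc : LocallyIntegrable (marginalMass ρ) volume)
    (τ τ' : ℝ → ℝ)
    (hτ : ∀ s, HasDerivAt τ (τ' s) s)
    (hτ' : Continuous τ') (hτpos : ∀ s, 0 < τ' s) (hτsurj : Function.Surjective τ)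
    (h1 : Integrable (fun p : ℝ × ℝ => ρ p.1 p.2 * Real.log (2 * π * ρ p.1 p.2)) timeTheta)
    (h2 : Integrable (fun t => marginalMass ρ t * Real.log (marginalMass ρ t)) volume)
    (h3 : Integrable (fun s => (τ' s * marginalMass ρ (τ s))
      * Real.log (τ' s * marginalMass ρ (τ s))) volume) :
    ∫ p, (τ' p.1 * ρ (τ p.1) p.2) * Real.log (2 * π * (τ' p.1 * ρ (τ p.1) p.2)) ∂timeTheta
        - ∫ s, (τ' s * marginalMass ρ (τ s)) * Real.log (τ' s * marginalMass ρ (τ s))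
      = ∫ p, ρ p.1 p.2 * Real.log (2 * π * ρ p.1 p.2) ∂timeTheta
        - ∫ t, marginalMass ρ t * Real.log (marginalMass ρ t) := by
  have hmp := aux_mp τ τ' hτ hτpos hτsurj
  have hτc : Measurable τ := hmp.measurable
  have hτm : Measurable τ' := hτ'.measurable
  set ν : Measure ℝ := (volume : Measure ℝ).restrict (Set.Ioc 0 (2 * π)) with hν
  have hmp2 : MeasurePreserving (Prod.map τ id)
      (timeTheta.withDensity (fun p => ENNReal.ofReal (τ' p.1))) timeTheta := by
    have := hmp.prod (MeasurePreserving.id ν)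
    rwa [prod_withDensity_left hτm.ennreal_ofReal] at this
  obtain ⟨hA, hA'⟩ := aux_cov timeTheta (fun p => τ' p.1) (hτm.comp measurable_fst)
    (fun p => (hτpos _).le) _ hmp2 _ h1
  obtain ⟨hB, hB'⟩ := aux_cov volume τ' hτm (fun p => (hτpos _).le) _ hmp _ h2
  simp only [Prod.map_fst, Prod.map_snd, id] at hA hA'
  -- fibre integrability
  have hρm : ∀ t, Measurable (ρ t) := fun t => hmeas.comp measurable_prodMk_left
  have hfib : ∀ᵐ s, Integrable (ρ (τ s)) ν := by
    have hA2 := hA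
    unfold timeTheta at hA2
    filter_upwards [hA2.prod_right_ae] with s hs
    have hs' : Integrable (fun θ => ρ (τ s) θ * Real.log (2 * π * ρ (τ s) θ)) ν := by
      have := hs.const_mul (τ' s)⁻¹
      simpa [inv_mul_cancel_left₀ (hτpos s).ne'] using this
    refine ((integrable_const (Real.exp 1)).add hs'.abs).mono' (hρm _).aestronglyMeasurable ?_
    refine ae_of_all _ fun θ => ?_
    rw [Real.norm_of_nonneg (hnonneg _ _)]
    exact aux_bound _ (hnonneg _ _)
  have hC0 : (fun s => (τ' s * marginalMass ρ (τ s)) * Real.log (τ' s * marginalMass ρ (τ s)))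
      = fun s => τ' s * (marginalMass ρ (τ s) * Real.log (marginalMass ρ (τ s)))
        + τ' s * marginalMass ρ (τ s) * Real.log (τ' s) := by
    funext s
    simpa using aux_log (τ' s) (marginalMass ρ (τ s)) (hτpos s) 1 one_pos
  have hC : Integrable (fun s => τ' s * marginalMass ρ (τ s) * Real.log (τ' s)) volume := by
    refine (h3.sub hB).congr (ae_of_all _ fun s => ?_)
    have := congrFun hC0 s
    simp only [Pi.sub_apply] at this ⊢
    linarith
  have hmm : ∀ s, 0 ≤ marginalMass ρ s := fun s => integral_nonneg fun θ => hnonneg _ _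
  have hDm : Measurable (fun p : ℝ × ℝ => τ' p.1 * ρ (τ p.1) p.2 * Real.log (τ' p.1)) := by
    have h1 : Measurable (fun p : ℝ × ℝ => ρ (τ p.1) p.2) :=
      hmeas.comp ((hτc.comp measurable_fst).prodMk measurable_snd)
    have h2 : Measurable (fun p : ℝ × ℝ => τ' p.1) := hτm.comp measurable_fst
    exact (h2.mul h1).mul h2.log
  have hD : Integrable (fun p : ℝ × ℝ => τ' p.1 * ρ (τ p.1) p.2 * Real.log (τ' p.1))
      timeTheta := by
    unfold timeTheta
    rw [integrable_prod_iff hDm.aestronglyMeasurable]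
    constructor
    · filter_upwards [hfib] with s hs
      exact (hs.const_mul _).mul_const _
    · refine hC.norm.congr (ae_of_all _ fun s => ?_)
      simp only [norm_mul, Real.norm_of_nonneg (hnonneg _ _), Real.norm_of_nonneg (hmm _)]
      rw [integral_mul_const, integral_const_mul]
      rfl
  have hD' : ∫ p, τ' p.1 * ρ (τ p.1) p.2 * Real.log (τ' p.1) ∂timeTheta
      = ∫ s, τ' s * marginalMass ρ (τ s) * Real.log (τ' s) := by
    have hD2 := hD
    unfold timeTheta at hD2 ⊢
    rw [integral_prod _ hD2]
    refine integral_congr_ae (ae_of_all _ fun s => ?_)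
    simp only
    rw [integral_mul_const, integral_const_mul]
    rfl
  rw [hC0, integral_add hB hC, hB']
  have hE : (fun p : ℝ × ℝ => (τ' p.1 * ρ (τ p.1) p.2)
      * Real.log (2 * π * (τ' p.1 * ρ (τ p.1) p.2)))
      = fun p => τ' p.1 * (ρ (τ p.1) p.2 * Real.log (2 * π * ρ (τ p.1) p.2))
        + τ' p.1 * ρ (τ p.1) p.2 * Real.log (τ' p.1) := by
    funext p
    exact aux_log _ _ (hτpos _) _ (by positivity)
  rw [hE, integral_add hA hD, hA', hD']
  ring

end
end

section
/- Explicit integral evaluation (used in the cusp example of Section 4.3): For every real a > 0, ∫₀^a x·log x / √(a − x) dx = (4/9)·a^{3/2}·(3 log a − 5 + log 64). -/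
open Real intervalIntegral

/-- **Explicit integral evaluation** (used in the cusp example of Section 4.3):
for every `a > 0`, `∫₀^a x log x / √(a−x) dx = (4/9)·a^{3/2}·(3 log a − 5 + log 64)`. -/
theorem integral_xlogx_div_sqrt (a : ℝ) (ha : 0 < a) :
    ∫ x in (0 : ℝ)..a, x * Real.log x / Real.sqrt (a - x)
      = (4 / 9) * a ^ ((3 : ℝ) / 2) * (3 * Real.log a - 5 + Real.log 64) := by
  obtain ⟨b, hb, hab⟩ : ∃ b : ℝ, 0 < b ∧ a = b ^ 2 :=
    ⟨√a, Real.sqrt_pos.2 ha, (Real.sq_sqrt ha.le).symm⟩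
  have hpos : ∀ x, b + √(a - x) ≠ 0 := fun x => by positivity
  have hxl : Continuous fun x : ℝ => x * Real.log x := Real.continuous_mul_log
  have hint : IntervalIntegrable (fun x => x * Real.log x / √(a - x)) MeasureTheory.volume 0 a := by
    have h1 : IntervalIntegrable (fun x : ℝ => x ^ (-(1 / 2) : ℝ)) MeasureTheory.volume a 0 :=
      intervalIntegral.intervalIntegrable_rpow' (by norm_num)
    have h2 := h1.comp_sub_left a
    simp only [sub_self, sub_zero] at h2
    refine (h2.continuousOn_mul hxl.continuousOn).congr ?_
    intro x hx
    rw [Set.uIoc_of_le ha.le] at hx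
    have : 0 ≤ a - x := by linarith [hx.2]
    simp only [Real.rpow_neg this, Real.sqrt_eq_rpow, div_eq_mul_inv]
  have key := intervalIntegral.integral_eq_sub_of_hasDerivAt_of_le (a := 0) (b := a)
    (f := fun x => 2 / 3 * (x * Real.log x) * (2 * a / (b + √(a - x)) - √(a - x))
      + 8 * a / 3 * √(a - x) - 8 / 3 * a * b * Real.log (b + √(a - x)) - 4 / 9 * √(a - x) ^ 3)
    (f' := fun x => x * Real.log x / √(a - x)) ha.le ?_ ?_ hint
  · rw [key]
    have e1 : a ^ ((3 : ℝ) / 2) = b ^ 3 := by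
      rw [hab, ← Real.rpow_natCast, ← Real.rpow_mul hb.le, ← Real.rpow_natCast]; norm_num
    have e2 : √a = b := by rw [hab, Real.sqrt_sq hb.le]
    have e3 : Real.log 64 = 6 * Real.log 2 := by
      rw [show (64 : ℝ) = 2 ^ 6 by norm_num, Real.log_pow]; norm_num
    have e4 : Real.log a = 2 * Real.log b := by rw [hab, Real.log_pow]; norm_num
    have e5 : Real.log (b + b) = Real.log 2 + Real.log b := by
      rw [← two_mul, Real.log_mul (by norm_num) hb.ne']
    simp only [sub_self, sub_zero, Real.sqrt_zero, add_zero, e1, e2, e3, e4, e5]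
    rw [hab]
    field_simp
    ring
  · apply Continuous.continuousOn
    have hs : Continuous fun x : ℝ => √(a - x) := by fun_prop
    have hbs : Continuous fun x : ℝ => b + √(a - x) := by fun_prop
    have hl := hbs.log hpos
    have hd := (continuous_const (y := 2 * a)).div hbs hpos
    fun_prop
  · intro x hx
    have hx0 := hx.1.ne'
    have hax : 0 < a - x := sub_pos.2 hx.2
    have hs0 : 0 < √(a - x) := Real.sqrt_pos.2 hax
    have hs : HasDerivAt (fun x : ℝ => √(a - x)) (-1 / (2 * √(a - x))) x :=
      ((hasDerivAt_id x).const_sub a).sqrt hax.ne'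
    have hl := (hs.const_add b).log (hpos x)
    have hd := (hasDerivAt_const x (2 * a)).div (hs.const_add b) (hpos x)
    have hxl := Real.hasDerivAt_mul_log hx0
    have H := ((((hxl.const_mul (2 / 3)).mul (hd.sub hs)).add (hs.const_mul (8 * a / 3))).sub
      (hl.const_mul (8 / 3 * a * b))).sub ((hs.pow 3).const_mul (4 / 9))
    refine H.congr_deriv ?_
    have hp := hpos x
    have hsq : √(a - x) ^ 2 = a - x := Real.sq_sqrt hax.le
    simp only [Pi.div_apply, Pi.sub_apply]
    generalize √(a - x) = s at *
    have hxe : x = b ^ 2 - s ^ 2 := by rw [hsq, ← hab]; ring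
    generalize Real.log x = L at *
    subst hxe
    subst hab
    field_simp
    ring
end

section
/- Entropy bound for the Poisson kernel density (Section 4.3, outward-pointing cusps example): For every R > 1, let P_R(θ) = (R² − 1)/(1 − 2R cos θ + R²) for θ ∈ [0,2π]. Then (1/2π)∫₀^{2π} P_R(θ) log P_R(θ) dθ ≤ (2/π)·arcsin(√((R−1)/(2R)))·((R+1)/(R−1))·log((R+1)/(R−1)). -/
open Real intervalIntegral

/-- **Entropy bound for the Poisson kernel density** (Section 4.3, outward-pointing cusps
example): for `R > 1` and `P_R(θ) = (R²−1)/(1−2R cos θ + R²)`, the relative entropy of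
`P_R(θ) dθ/2π` with respect to the uniform measure satisfies
`(1/2π)∫₀^{2π} P_R log P_R dθ ≤ (2/π)·arcsin(√((R−1)/(2R)))·((R+1)/(R−1))·log((R+1)/(R−1))`. -/
theorem poisson_kernel_entropy_bound (R : ℝ) (hR : 1 < R) :
    (2 * π)⁻¹ * ∫ θ in (0 : ℝ)..(2 * π),
        ((R ^ 2 - 1) / (1 - 2 * R * Real.cos θ + R ^ 2))
          * Real.log ((R ^ 2 - 1) / (1 - 2 * R * Real.cos θ + R ^ 2))
      ≤ (2 / π) * Real.arcsin (Real.sqrt ((R - 1) / (2 * R)))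
          * ((R + 1) / (R - 1)) * Real.log ((R + 1) / (R - 1)) := by
  have hD : ∀ θ : ℝ, 0 < 1 - 2 * R * Real.cos θ + R ^ 2 := by
    intro θ
    nlinarith [Real.cos_le_one θ, Real.neg_one_le_cos θ, sq_nonneg (R - 1)]
  have hR2 : 0 < R ^ 2 - 1 := by nlinarith
  have hP : ∀ θ : ℝ, 0 < (R ^ 2 - 1) / (1 - 2 * R * Real.cos θ + R ^ 2) :=
    fun θ => div_pos hR2 (hD θ)
  have hM1 : 1 ≤ (R + 1) / (R - 1) := by
    rw [le_div_iff₀ (by linarith)]; linarith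
  have hPM : ∀ θ : ℝ, (R ^ 2 - 1) / (1 - 2 * R * Real.cos θ + R ^ 2) ≤ (R + 1) / (R - 1) := by
    intro θ
    rw [div_le_div_iff₀ (hD θ) (by linarith)]
    have h1 : (R - 1) ^ 2 ≤ 1 - 2 * R * Real.cos θ + R ^ 2 := by
      nlinarith [Real.cos_le_one θ]
    nlinarith
  set f : ℝ → ℝ := fun θ => ((R ^ 2 - 1) / (1 - 2 * R * Real.cos θ + R ^ 2))
          * Real.log ((R ^ 2 - 1) / (1 - 2 * R * Real.cos θ + R ^ 2)) with hf
  set C : ℝ := ((R + 1) / (R - 1)) * Real.log ((R + 1) / (R - 1)) with hC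
  have hC0 : 0 ≤ C := mul_nonneg (by linarith) (Real.log_nonneg hM1)
  have hcont : Continuous f := by
    have h1 : Continuous fun θ : ℝ => (R ^ 2 - 1) / (1 - 2 * R * Real.cos θ + R ^ 2) :=
      Continuous.div (by fun_prop) (by fun_prop) (fun θ => (hD θ).ne')
    exact h1.mul (h1.log (fun θ => (hP θ).ne'))
  have hfC : ∀ θ, f θ ≤ C := by
    intro θ
    rcases le_total 1 ((R ^ 2 - 1) / (1 - 2 * R * Real.cos θ + R ^ 2)) with h | h
    · exact mul_le_mul (hPM θ) (Real.log_le_log (hP θ) (hPM θ)) (Real.log_nonneg h) (by linarith)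
    · exact (mul_nonpos_of_nonneg_of_nonpos (hP θ).le (Real.log_nonpos (hP θ).le h)).trans hC0
  set s : ℝ := Real.sqrt ((R - 1) / (2 * R)) with hs
  have hs2 : s ^ 2 = (R - 1) / (2 * R) :=
    Real.sq_sqrt (div_nonneg (by linarith) (by linarith))
  have hs0 : 0 ≤ s := Real.sqrt_nonneg _
  have hs1 : s ≤ 1 := by
    have : s ^ 2 ≤ 1 := by
      rw [hs2, div_le_one (by linarith)]; linarith
    nlinarith
  set a : ℝ := 2 * Real.arcsin s with ha
  have ha0 : 0 ≤ a := by have := Real.arcsin_nonneg.2 hs0; linarith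
  have hapi : a ≤ π := by have := Real.arcsin_le_pi_div_two s; linarith
  have hcosa : Real.cos a = 1 / R := by
    rw [ha, Real.cos_two_mul, Real.cos_sq', Real.sin_arcsin (by linarith) hs1, hs2]
    field_simp
    ring
  have hmid : ∀ θ ∈ Set.Icc a (2 * π - a), f θ ≤ 0 := by
    intro θ hθ
    have h1 : Real.cos (π - a) ≤ Real.cos |θ - π| := by
      apply Real.cos_le_cos_of_nonneg_of_le_pi (abs_nonneg _) (by linarith)
      rw [abs_le]
      constructor <;> linarith [hθ.1, hθ.2]
    rw [Real.cos_abs, Real.cos_pi_sub, Real.cos_sub_pi, hcosa] at h1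
    have h2 : Real.cos θ ≤ 1 / R := by linarith
    rw [le_div_iff₀ (by linarith)] at h2
    apply mul_nonpos_of_nonneg_of_nonpos (hP θ).le
    apply Real.log_nonpos (hP θ).le
    rw [div_le_one (hD θ)]
    linarith
  have hint : ∀ x y, IntervalIntegrable f MeasureTheory.volume x y :=
    fun x y => hcont.intervalIntegrable x y
  have hsplit : ∫ θ in (0 : ℝ)..(2 * π), f θ = (∫ θ in (0 : ℝ)..a, f θ)
      + (∫ θ in a..(2 * π - a), f θ) + ∫ θ in (2 * π - a)..(2 * π), f θ := by
    rw [integral_add_adjacent_intervals (hint _ _) (hint _ _),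
      integral_add_adjacent_intervals (hint _ _) (hint _ _)]
  have hb : ∀ x y K : ℝ, x ≤ y → (∀ θ ∈ Set.Icc x y, f θ ≤ K) →
      ∫ θ in x..y, f θ ≤ (y - x) * K := by
    intro x y K hxy h
    have := integral_mono_on hxy (hint x y) (intervalIntegrable_const (c := K)) h
    simpa using this
  have i1 := hb 0 a C ha0 (fun θ _ => hfC θ)
  have i2 := hb a (2 * π - a) 0 (by linarith) hmid
  have i3 := hb (2 * π - a) (2 * π) C (by linarith) (fun θ _ => hfC θ)
  have htot : ∫ θ in (0 : ℝ)..(2 * π), f θ ≤ 2 * a * C := by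
    rw [hsplit]; linarith
  have hpi := Real.pi_pos
  calc (2 * π)⁻¹ * ∫ θ in (0 : ℝ)..(2 * π), f θ ≤ (2 * π)⁻¹ * (2 * a * C) :=
        mul_le_mul_of_nonneg_left htot (by positivity)
    _ = (2 / π) * Real.arcsin s * ((R + 1) / (R - 1)) * Real.log ((R + 1) / (R - 1)) := by
        rw [mul_assoc (2 / π * Real.arcsin s), ← hC, ha]
        field_simp
end

section
/- The orthogonal-disks density is a probability density with finite total entropy (Section 4.3, inward-pointing corner example; analytic part of Theorem 1.6(iii)): For t > 0 let I_t = [2 arcsin(e^{−t}), 2π − 2 arcsin(e^{−t})] and define ρ̃_t(θ) = (e^{−t}/(π(1 − e^{−2t}))) · sin(θ/2) · √(e^{2t} sin²(θ/2) − 1) for θ ∈ I_t and ρ̃_t(θ) = 0 for θ ∈ [0,2π] \ I_t. Then: (a) for every t > 0, ∫₀^{2π} ρ̃_t(θ) dθ = 1; and (b) ∫₀^1 ( ∫₀^{2π} ρ̃_t(θ) log(2π ρ̃_t(θ)) dθ ) dt < ∞. -/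
open MeasureTheory Real Set intervalIntegral
open scoped ENNReal

noncomputable section

/-- The driving density of the orthogonal-disks (inward-pointing corner) example of
Section 4.3: `ρ̃_t(θ) = (e^{−t}/(π(1−e^{−2t}))) sin(θ/2) √(e^{2t} sin²(θ/2) − 1)` on
`I_t = [2 arcsin e^{−t}, 2π − 2 arcsin e^{−t}]`, and `0` off `I_t`. -/
def rhoOrth (t θ : ℝ) : ℝ :=
  if θ ∈ Set.Icc (2 * Real.arcsin (Real.exp (-t))) (2 * π - 2 * Real.arcsin (Real.exp (-t)))
  then (Real.exp (-t) / (π * (1 - Real.exp (-2 * t)))) * Real.sin (θ / 2)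
        * Real.sqrt (Real.exp (2 * t) * Real.sin (θ / 2) ^ 2 - 1)
  else 0

lemma rhoOrth_eq (t : ℝ) (ht : 0 < t) (θ : ℝ) (h0 : 0 ≤ θ) (h1 : θ ≤ 2 * π) :
    rhoOrth t θ = (1 / (π * (1 - Real.exp (-2 * t)))) *
      (Real.sqrt ((1 - Real.exp (-2 * t)) - Real.cos (θ / 2) ^ 2) * Real.sin (θ / 2)) := by
  have ha : 0 < Real.exp (-t) := Real.exp_pos _
  have ha1 : Real.exp (-t) ≤ 1 := by
    rw [Real.exp_le_one_iff]; linarith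
  have hsq : Real.exp (-2 * t) = Real.exp (-t) ^ 2 := by
    rw [← Real.exp_nat_mul]; congr 1; push_cast; ring
  have hinv : Real.exp (-t) ^ 2 * Real.exp (2 * t) = 1 := by
    rw [← hsq, ← Real.exp_add]; simp
  have hcos : Real.cos (θ / 2) ^ 2 = 1 - Real.sin (θ / 2) ^ 2 := Real.cos_sq' _
  have hs : 0 ≤ Real.sin (θ / 2) := Real.sin_nonneg_of_nonneg_of_le_pi (by linarith) (by linarith)
  have hle : Real.arcsin (Real.exp (-t)) ≤ π / 2 := Real.arcsin_le_pi_div_two _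
  have hsin : Real.sin (Real.arcsin (Real.exp (-t))) = Real.exp (-t) :=
    Real.sin_arcsin (by linarith) ha1
  unfold rhoOrth
  split_ifs with h
  · have : Real.sqrt ((1 - Real.exp (-2 * t)) - Real.cos (θ / 2) ^ 2)
        = Real.exp (-t) * Real.sqrt (Real.exp (2 * t) * Real.sin (θ / 2) ^ 2 - 1) := by
      rw [← Real.sqrt_sq ha.le, ← Real.sqrt_mul (sq_nonneg _)]
      congr 1
      rw [hcos, hsq]
      linear_combination (-Real.sin (θ / 2) ^ 2) * hinv
    rw [this]; ring
  · have hsa : Real.sin (θ / 2) ≤ Real.exp (-t) := by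
      rw [Set.mem_Icc, not_and_or, not_le, not_le] at h
      rw [← hsin]
      rcases h with h | h
      · exact Real.sin_le_sin_of_le_of_le_pi_div_two (by linarith [Real.pi_pos]) hle (by linarith)
      · rw [← Real.sin_pi_sub]
        exact Real.sin_le_sin_of_le_of_le_pi_div_two (by linarith [Real.pi_pos]) hle (by linarith)
    rw [Real.sqrt_eq_zero_of_nonpos]
    · simp
    · rw [hcos, hsq]; nlinarith

lemma semicircle (b : ℝ) (hb : 0 < b) (hb1 : b ≤ 1) :
    ∫ x in (-1 : ℝ)..1, Real.sqrt (b ^ 2 - x ^ 2) = b ^ 2 * (π / 2) := by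
  have hc : Continuous fun x : ℝ => Real.sqrt (b ^ 2 - x ^ 2) := by fun_prop
  have hi := fun u v : ℝ => hc.intervalIntegrable (μ := volume) u v
  have h1 : ∫ x in (-1 : ℝ)..(-b), Real.sqrt (b ^ 2 - x ^ 2) = 0 := by
    rw [intervalIntegral.integral_congr (g := fun _ => 0)]
    · simp
    · intro x hx
      rw [Set.uIcc_of_le (by linarith)] at hx
      exact Real.sqrt_eq_zero_of_nonpos (by nlinarith [hx.1, hx.2])
  have h2 : ∫ x in b..1, Real.sqrt (b ^ 2 - x ^ 2) = 0 := by
    rw [intervalIntegral.integral_congr (g := fun _ => 0)]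
    · simp
    · intro x hx
      rw [Set.uIcc_of_le (by linarith)] at hx
      exact Real.sqrt_eq_zero_of_nonpos (by nlinarith [hx.1, hx.2])
  have h3 : ∫ x in (-b)..b, Real.sqrt (b ^ 2 - x ^ 2) = b ^ 2 * (π / 2) := by
    have := intervalIntegral.mul_integral_comp_mul_left (a := -1) (b := 1)
      (f := fun x : ℝ => Real.sqrt (b ^ 2 - x ^ 2)) b
    simp only [mul_neg, mul_one] at this
    rw [← this]
    have e : ∀ x : ℝ, Real.sqrt (b ^ 2 - (b * x) ^ 2) = b * Real.sqrt (1 - x ^ 2) := by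
      intro x
      rw [show b ^ 2 - (b * x) ^ 2 = b ^ 2 * (1 - x ^ 2) by ring, Real.sqrt_mul (sq_nonneg _),
        Real.sqrt_sq hb.le]
    simp_rw [e]
    rw [intervalIntegral.integral_const_mul, integral_sqrt_one_sub_sq]; ring
  rw [← intervalIntegral.integral_add_adjacent_intervals (hi (-1) (-b)) (hi (-b) 1),
    ← intervalIntegral.integral_add_adjacent_intervals (hi (-b) b) (hi b 1), h1, h2, h3]
  ring

lemma one_sub_exp_bounds (t : ℝ) (ht : 0 < t) :
    0 < 1 - Real.exp (-2 * t) ∧ 1 - Real.exp (-2 * t) ≤ 1 := by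
  have := Real.exp_pos (-2 * t)
  have : Real.exp (-2 * t) < 1 := by rw [Real.exp_lt_one_iff]; linarith
  constructor <;> linarith

lemma rhoOrth_integral (t : ℝ) (ht : 0 < t) : (∫ θ in (0 : ℝ)..(2 * π), rhoOrth t θ) = 1 := by
  obtain ⟨hB, hB1⟩ := one_sub_exp_bounds t ht
  have hpi := Real.pi_pos
  rw [intervalIntegral.integral_congr (g := fun θ => (1 / (π * (1 - Real.exp (-2 * t)))) *
      (Real.sqrt ((1 - Real.exp (-2 * t)) - Real.cos (θ / 2) ^ 2) * Real.sin (θ / 2)))]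
  swap
  · intro θ hθ
    rw [Set.uIcc_of_le (by positivity)] at hθ
    exact rhoOrth_eq t ht θ hθ.1 hθ.2
  generalize 1 - Real.exp (-2 * t) = B at hB hB1
  rw [intervalIntegral.integral_const_mul]
  have key := intervalIntegral.integral_comp_mul_deriv (a := 0) (b := 2 * π)
    (f := fun θ : ℝ => Real.cos (θ / 2)) (f' := fun θ : ℝ => -Real.sin (θ / 2) * (1 / 2))
    (g := fun x : ℝ => Real.sqrt (B - x ^ 2))
    (fun x _ => ((hasDerivAt_id x).div_const 2).cos) (by fun_prop) (by fun_prop)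
  have hsc := semicircle (Real.sqrt B) (Real.sqrt_pos.2 hB) (Real.sqrt_le_one.2 hB1)
  rw [Real.sq_sqrt hB.le] at hsc
  have e0 : Real.cos (2 * π / 2) = -1 := by
    rw [show 2 * π / 2 = π by ring, Real.cos_pi]
  simp only [e0, zero_div, Real.cos_zero] at key
  rw [intervalIntegral.integral_symm (-1) 1, hsc] at key
  have e1 : ∫ θ in (0 : ℝ)..(2 * π), Real.sqrt (B - Real.cos (θ / 2) ^ 2) * Real.sin (θ / 2)
      = (-2) * ∫ θ in (0 : ℝ)..(2 * π), ((fun x : ℝ => Real.sqrt (B - x ^ 2)) ∘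
        (fun θ : ℝ => Real.cos (θ / 2))) θ * (-Real.sin (θ / 2) * (1 / 2)) := by
    rw [← intervalIntegral.integral_const_mul]
    congr 1
    ext θ
    simp only [Function.comp]
    ring
  rw [e1, key]
  field_simp

lemma rhoOrth_entropy_le (t : ℝ) (ht : 0 < t) (ht1 : t ≤ 1) :
    (∫ θ in (0 : ℝ)..(2 * π), rhoOrth t θ * Real.log (2 * π * rhoOrth t θ))
      ≤ 4 * t ^ (-(1 / 2) : ℝ) := by
  have hint := rhoOrth_integral t ht
  have hpi := Real.pi_pos
  obtain ⟨hB, hB1⟩ := one_sub_exp_bounds t ht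
  have hBt : t / 2 ≤ 1 - Real.exp (-2 * t) := by
    have h := Real.add_one_le_exp (2 * t)
    have h2 : Real.exp (-2 * t) * Real.exp (2 * t) = 1 := by rw [← Real.exp_add]; simp
    have h3 := Real.exp_pos (-2 * t)
    nlinarith
  have heq := rhoOrth_eq t ht
  generalize 1 - Real.exp (-2 * t) = B at hB hB1 hBt heq
  have hb := Real.sqrt_pos.2 hB
  have hbb := Real.sq_sqrt hB.le
  have hb1 : Real.sqrt B ≤ 1 := Real.sqrt_le_one.2 hB1
  have hcont : ContinuousOn (fun θ => rhoOrth t θ) (Set.uIcc 0 (2 * π)) := by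
    have : Continuous (fun θ : ℝ => (1 / (π * B)) *
      (Real.sqrt (B - Real.cos (θ / 2) ^ 2) * Real.sin (θ / 2))) := by fun_prop
    refine this.continuousOn.congr ?_
    intro θ hθ
    rw [Set.uIcc_of_le (by positivity)] at hθ
    exact heq θ hθ.1 hθ.2
  have hcont2 : ContinuousOn (fun θ => rhoOrth t θ * Real.log (2 * π * rhoOrth t θ))
      (Set.uIcc 0 (2 * π)) := by
    have : ContinuousOn (fun θ => (1 / (2 * π)) *
        ((2 * π * rhoOrth t θ) * Real.log (2 * π * rhoOrth t θ))) (Set.uIcc 0 (2 * π)) :=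
      continuousOn_const.mul
        (Real.continuous_mul_log.comp_continuousOn (continuousOn_const.mul hcont))
    refine this.congr ?_
    intro θ _
    simp only
    field_simp
  have hmono : (∫ θ in (0 : ℝ)..(2 * π), rhoOrth t θ * Real.log (2 * π * rhoOrth t θ))
      ≤ ∫ θ in (0 : ℝ)..(2 * π), rhoOrth t θ * (2 / Real.sqrt B) := by
    refine intervalIntegral.integral_mono_on (by positivity) hcont2.intervalIntegrable
      (hcont.intervalIntegrable.mul_const _) ?_
    intro θ hθ
    have hs : 0 ≤ Real.sin (θ / 2) :=
      Real.sin_nonneg_of_nonneg_of_le_pi (by linarith [hθ.1]) (by linarith [hθ.2])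
    have h0 : 0 ≤ rhoOrth t θ := by
      rw [heq θ hθ.1 hθ.2]; positivity
    have hup : 2 * π * rhoOrth t θ ≤ 2 / Real.sqrt B := by
      rw [heq θ hθ.1 hθ.2]
      have hq : Real.sqrt (B - Real.cos (θ / 2) ^ 2) ≤ Real.sqrt B :=
        Real.sqrt_le_sqrt (by nlinarith [sq_nonneg (Real.cos (θ / 2))])
      have hm : Real.sqrt (B - Real.cos (θ / 2) ^ 2) * Real.sin (θ / 2) ≤ Real.sqrt B * 1 :=
        mul_le_mul hq (Real.sin_le_one _) hs hb.le
      have : 2 / Real.sqrt B = 2 * π * (1 / (π * B) * (Real.sqrt B * 1)) := by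
        rw [div_eq_iff hb.ne']
        field_simp
        nlinarith
      rw [this]
      gcongr
    refine mul_le_mul_of_nonneg_left ?_ h0
    exact (Real.log_le_self (by positivity)).trans hup
  rw [intervalIntegral.integral_mul_const, hint, one_mul] at hmono
  refine hmono.trans ?_
  rw [Real.rpow_neg ht.le, ← Real.sqrt_eq_rpow]
  have hst := Real.sqrt_pos.2 ht
  have : Real.sqrt t ≤ 2 * Real.sqrt B := by
    rw [Real.sqrt_le_left (by positivity), mul_pow, hbb]
    linarith
  rw [← div_eq_mul_inv, div_le_div_iff₀ hb hst]
  linarith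

/-- **The orthogonal-disks density is a probability density with finite total entropy**
(Section 4.3, inward-pointing corner example; analytic part of Theorem 1.6(iii)):
(a) for every `t > 0` the density `ρ̃_t` integrates to `1` over `[0,2π]`, and
(b) the total entropy `∫₀¹ ∫₀^{2π} ρ̃_t log(2π ρ̃_t) dθ dt` is finite (each inner
integral being nonnegative by Jensen's inequality). -/
theorem rhoOrth_prob_and_finite_entropy :
    (∀ t : ℝ, 0 < t → (∫ θ in (0 : ℝ)..(2 * π), rhoOrth t θ) = 1) ∧
    ((∫⁻ t in Set.Ioc (0 : ℝ) 1,
        ENNReal.ofReal (∫ θ in (0 : ℝ)..(2 * π),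
          rhoOrth t θ * Real.log (2 * π * rhoOrth t θ))) < ⊤) := by
  refine ⟨rhoOrth_integral, ?_⟩
  have hI : IntegrableOn (fun t : ℝ => 4 * t ^ (-(1 / 2) : ℝ)) (Set.Ioc 0 1) := by
    have := (intervalIntegral.intervalIntegrable_rpow' (a := 0) (b := 1)
      (r := (-(1 / 2) : ℝ)) (by norm_num)).const_mul 4
    rwa [intervalIntegrable_iff_integrableOn_Ioc_of_le zero_le_one] at this
  refine lt_of_le_of_lt ?_ hI.lintegral_lt_top
  refine setLIntegral_mono' measurableSet_Ioc fun t ht => ?_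
  exact ENNReal.ofReal_le_ofReal (rhoOrth_entropy_le t ht.1 ht.2)

end
end
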